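/- A convex lattice polygon in ℤ² with more than 6 vertices cannot be lattice-regular. In particular, any lattice-regular convex lattice polygon has 3, 4, or 6 vertices. -/

import Mathlib

/-- The real point corresponding to an integer point. -/
def toR2 (v : Fin 2 → ℤ) : Fin 2 → ℝ := fun i => (v i : ℝ)

/-- The points `V 0, …, V (m-1)` are in strictly convex position:
each one is a vertex (extreme point) of the convex hull of all of them. -/
def ConvexPosition (m : ℕ) (V : Fin m → Fin 2 → ℤ) : Prop :=
  ∀ i, toR2 (V i) ∉ convexHull ℝ (toR2 '' (V '' {j | j ≠ i}))

/-- `(u, w)` is a face-flag of the polygon with vertices `V 0, …, V (m-1)`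
(in cyclic order): `u` is a vertex of the polygon and `w` is the other
endpoint of an edge at `u`. -/
def AdjPair (m : ℕ) [NeZero m] (V : Fin m → Fin 2 → ℤ) (u w : Fin 2 → ℤ) : Prop :=
  ∃ i : Fin m, (u = V i ∧ w = V (i + 1)) ∨ (u = V (i + 1) ∧ w = V i)

/-- The polygon with vertices `V 0, …, V (m-1)` (in cyclic order) is
lattice-regular: for any two face-flags there is a lattice-affine
transformation preserving the polygon and taking one flag to the other. -/
def LatticeRegular (m : ℕ) [NeZero m] (V : Fin m → Fin 2 → ℤ) : Prop :=
  ∀ u w u' w' : Fin 2 → ℤ, AdjPair m V u w → AdjPair m V u' w' →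
    ∃ (A : Matrix (Fin 2) (Fin 2) ℤ) (b : Fin 2 → ℤ),
      (A.det = 1 ∨ A.det = -1) ∧
      ((fun x => A.mulVec x + b) '' Set.range V = Set.range V) ∧
      A.mulVec u + b = u' ∧ A.mulVec w + b = w'

open Matrix

/-- m V i - sum V -/
def Wv (m : ℕ) (V : Fin m → Fin 2 → ℤ) (i : Fin m) : Fin 2 → ℤ :=
  (m : ℤ) • V i - ∑ j, V j

lemma Wv_inj (m : ℕ) (hm : 3 ≤ m) (V : Fin m → Fin 2 → ℤ) (hinj : Function.Injective V) :
    Function.Injective (Wv m V) := by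
  intro i j h
  apply hinj
  unfold Wv at h
  have h2 := sub_left_injective h
  ext k
  have := congrFun h2 k
  simp only [Pi.smul_apply, smul_eq_mul] at this
  have hm' : (m : ℤ) ≠ 0 := by omega
  exact mul_left_cancel₀ hm' this

lemma Wv_ne_zero (m : ℕ) (hm : 3 ≤ m) (V : Fin m → Fin 2 → ℤ)
    (hconv : ConvexPosition m V) (i : Fin m) : Wv m V i ≠ 0 := by
  intro h
  apply hconv i
  have hm1 : (0 : ℝ) < (m : ℝ) - 1 := by
    have : (3 : ℝ) ≤ m := by exact_mod_cast hm
    linarith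
  have key : toR2 (V i) = ∑ j ∈ Finset.univ.erase i, ((m : ℝ) - 1)⁻¹ • toR2 (V j) := by
    rw [← Finset.smul_sum, eq_inv_smul_iff₀ hm1.ne']
    ext k
    have h1 := congrFun h k
    simp only [Wv, Pi.sub_apply, Pi.smul_apply, smul_eq_mul, Finset.sum_apply, Pi.zero_apply] at h1
    rw [← Finset.add_sum_erase _ _ (Finset.mem_univ i)] at h1
    have h2 : (m : ℝ) * V i k - (V i k + ∑ j ∈ Finset.univ.erase i, (V j k : ℝ)) = 0 := by
      exact_mod_cast h1
    simp only [Pi.smul_apply, smul_eq_mul, Finset.sum_apply, toR2]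
    linarith
  rw [key]
  apply (convex_convexHull ℝ _).sum_mem
  · intro j _; positivity
  · rw [Finset.sum_const, Finset.card_erase_of_mem (Finset.mem_univ i), Finset.card_univ,
      Fintype.card_fin, nsmul_eq_mul, Nat.cast_sub (by omega)]
    push_cast
    exact mul_inv_cancel₀ hm1.ne'
  · intro j hj
    apply subset_convexHull
    exact ⟨V j, ⟨j, by simpa using hj, rfl⟩, rfl⟩

lemma not_wbtw (m : ℕ) (V : Fin m → Fin 2 → ℤ)
    (hconv : ConvexPosition m V) (i j k : Fin m) (hij : i ≠ j) (hkj : k ≠ j) :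
    ¬ Wbtw ℝ (toR2 (V i)) (toR2 (V j)) (toR2 (V k)) := by
  intro h
  apply hconv j
  have h1 := h.mem_segment
  refine (convex_convexHull ℝ _).segment_subset ?_ ?_ h1
  · exact subset_convexHull _ _ ⟨V i, ⟨i, hij, rfl⟩, rfl⟩
  · exact subset_convexHull _ _ ⟨V k, ⟨k, hkj, rfl⟩, rfl⟩

lemma exists_cross (m : ℕ) (hm : 3 ≤ m) (V : Fin m → Fin 2 → ℤ)
    (hconv : ConvexPosition m V) :
    ∃ i j, Wv m V i 0 * Wv m V j 1 - Wv m V j 0 * Wv m V i 1 ≠ 0 := by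
  by_contra! hc
  let a : Fin m := ⟨0, by omega⟩
  let b : Fin m := ⟨1, by omega⟩
  let c : Fin m := ⟨2, by omega⟩
  have hab : a ≠ b := by simp [a, b]
  have hbc : b ≠ c := by simp [b, c]
  have hac : a ≠ c := by simp [a, c]
  have hm0 : (m : ℝ) ≠ 0 := by
    have : m ≠ 0 := by omega
    exact_mod_cast this
  have hw := Wv_ne_zero m hm V hconv a
  have hR : ∀ i k, (m : ℝ) * V i k = (Wv m V i k : ℝ) + ∑ j, (V j k : ℝ) := by
    intro i k
    simp [Wv]
  have hpar : ∀ i, ∃ r : ℝ, ∀ k, (Wv m V i k : ℝ) = r * Wv m V a k := by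
    intro i
    have h1 : (Wv m V a 0 : ℝ) * Wv m V i 1 - Wv m V i 0 * Wv m V a 1 = 0 := by
      exact_mod_cast hc a i
    by_cases h0 : Wv m V a 0 = 0
    · have h3 : Wv m V a 1 ≠ 0 := by
        intro h3
        apply hw
        ext k
        fin_cases k
        · exact h0
        · exact h3
      have h3' : (Wv m V a 1 : ℝ) ≠ 0 := by exact_mod_cast h3
      refine ⟨Wv m V i 1 / Wv m V a 1, fun k => ?_⟩
      fin_cases k
      · simp only [Fin.zero_eta]
        field_simp
        linarith
      · simp only [Fin.mk_one]
        field_simp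
    · have h3' : (Wv m V a 0 : ℝ) ≠ 0 := by exact_mod_cast h0
      refine ⟨Wv m V i 0 / Wv m V a 0, fun k => ?_⟩
      fin_cases k
      · simp only [Fin.zero_eta]
        field_simp
      · simp only [Fin.mk_one]
        field_simp
        linarith
  have hcol : Collinear ℝ {toR2 (V a), toR2 (V b), toR2 (V c)} := by
    rw [collinear_iff_exists_forall_eq_smul_vadd]
    refine ⟨fun k => (∑ j, (V j k : ℝ)) / m, fun k => (Wv m V a k : ℝ) / m, ?_⟩
    have : ∀ i, ∃ r : ℝ, toR2 (V i) =
        r • (fun k => (Wv m V a k : ℝ) / m) +ᵥ (fun k => (∑ j, (V j k : ℝ)) / m : Fin 2 → ℝ) := by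
      intro i
      obtain ⟨r, hr⟩ := hpar i
      refine ⟨r, ?_⟩
      ext k
      have h1 := hR i k
      rw [hr k] at h1
      simp only [toR2, vadd_eq_add, Pi.add_apply, Pi.smul_apply, smul_eq_mul]
      field_simp
      linarith
    rintro p (rfl | rfl | rfl)
    · exact this a
    · exact this b
    · exact this c
  rcases hcol.wbtw_or_wbtw_or_wbtw with h | h | h
  · exact not_wbtw m V hconv _ _ _ hab hbc.symm h
  · exact not_wbtw m V hconv _ _ _ hbc hac h
  · exact not_wbtw m V hconv _ _ _ hac.symm hab.symm h

/-- linear symmetries of a set -/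
def symG (T : Finset (Fin 2 → ℤ)) : Subgroup (GL (Fin 2) ℤ) where
  carrier := {g | ∀ x, (g : Matrix (Fin 2) (Fin 2) ℤ) *ᵥ x ∈ T ↔ x ∈ T}
  one_mem' := by intro x; simp
  mul_mem' := by
    intro g h hg hh x
    have h1 := hg ((h : Matrix (Fin 2) (Fin 2) ℤ) *ᵥ x)
    rw [Matrix.mulVec_mulVec] at h1
    have h2 := hh x
    rw [Units.val_mul, h1, h2]
  inv_mem' := by
    intro g hg x
    have h1 := hg (((g⁻¹ : GL (Fin 2) ℤ) : Matrix (Fin 2) (Fin 2) ℤ) *ᵥ x)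
    rw [Matrix.mulVec_mulVec, ← Units.val_mul, mul_inv_cancel, Units.val_one,
      Matrix.one_mulVec] at h1
    exact h1.symm

/-- The form relations. -/
lemma form_rel (T : Finset (Fin 2 → ℤ)) (g : GL (Fin 2) ℤ) (hg : g ∈ symG T)
    (f : (Fin 2 → ℤ) → ℤ) :
    ∑ v ∈ T, f ((g : Matrix (Fin 2) (Fin 2) ℤ) *ᵥ v) = ∑ v ∈ T, f v := by
  refine Finset.sum_nbij' (fun v => (g : Matrix (Fin 2) (Fin 2) ℤ) *ᵥ v)
    (fun v => ((g⁻¹ : GL (Fin 2) ℤ) : Matrix (Fin 2) (Fin 2) ℤ) *ᵥ v) ?_ ?_ ?_ ?_ ?_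
  · intro v hv; exact (hg v).2 hv
  · intro v hv; exact ((symG T).inv_mem hg v).2 hv
  · intro v _
    rw [Matrix.mulVec_mulVec, ← Units.val_mul, inv_mul_cancel, Units.val_one, Matrix.one_mulVec]
  · intro v _
    rw [Matrix.mulVec_mulVec, ← Units.val_mul, mul_inv_cancel, Units.val_one, Matrix.one_mulVec]
  · intro v _; rfl

lemma disc_pos (T : Finset (Fin 2 → ℤ)) (u w : Fin 2 → ℤ) (hu : u ∈ T) (hw : w ∈ T)
    (h : u 0 * w 1 - w 0 * u 1 ≠ 0) :
    0 < (∑ v ∈ T, v 0 ^ 2) * (∑ v ∈ T, v 1 ^ 2) - (∑ v ∈ T, v 0 * v 1) ^ 2 := by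
  have h1 : ∑ x ∈ T, ∑ y ∈ T, (x 0 * y 1 - y 0 * x 1) ^ 2 =
      2 * ((∑ v ∈ T, v 0 ^ 2) * (∑ v ∈ T, v 1 ^ 2) - (∑ v ∈ T, v 0 * v 1) ^ 2) := by
    have h2 : ∀ x ∈ T, ∑ y ∈ T, (x 0 * y 1 - y 0 * x 1) ^ 2 =
        x 0 ^ 2 * (∑ v ∈ T, v 1 ^ 2) - (x 0 * x 1) * (2 * ∑ v ∈ T, v 0 * v 1)
          + x 1 ^ 2 * (∑ v ∈ T, v 0 ^ 2) := by
      intro x _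
      rw [Finset.mul_sum, Finset.mul_sum, Finset.mul_sum, Finset.mul_sum, ← Finset.sum_sub_distrib,
        ← Finset.sum_add_distrib]
      apply Finset.sum_congr rfl
      intro y _; ring
    rw [Finset.sum_congr rfl h2, Finset.sum_add_distrib, Finset.sum_sub_distrib,
      ← Finset.sum_mul, ← Finset.sum_mul, ← Finset.sum_mul]
    ring
  have h3 : 0 < ∑ x ∈ T, ∑ y ∈ T, (x 0 * y 1 - y 0 * x 1) ^ 2 := by
    apply Finset.sum_pos' (fun x _ => Finset.sum_nonneg (fun y _ => sq_nonneg _))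
    refine ⟨u, hu, Finset.sum_pos' (fun y _ => sq_nonneg _) ⟨w, hw, ?_⟩⟩
    positivity
  linarith

/-- the form is preserved -/
def Pres (p q r : ℤ) (A : Matrix (Fin 2) (Fin 2) ℤ) : Prop :=
  A 1 0 * p = - (r * A 0 1) ∧ (A 1 1 - A 0 0) * p = 2 * A 0 1 * q

lemma pres_of_mem (T : Finset (Fin 2 → ℤ)) (g : GL (Fin 2) ℤ) (hg : g ∈ symG T)
    (hdet : (g : Matrix (Fin 2) (Fin 2) ℤ).det = 1) :
    Pres (∑ v ∈ T, v 0 ^ 2) (∑ v ∈ T, v 0 * v 1) (∑ v ∈ T, v 1 ^ 2) g := by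
  have e1 := form_rel T g hg (fun v => v 0 ^ 2)
  have e2 := form_rel T g hg (fun v => v 0 * v 1)
  have e3 := form_rel T g hg (fun v => v 1 ^ 2)
  rw [Matrix.det_fin_two] at hdet
  simp only [Matrix.mulVec, dotProduct, Fin.sum_univ_two] at e1 e2 e3
  set a := (g : Matrix (Fin 2) (Fin 2) ℤ) 0 0 with ha
  set b := (g : Matrix (Fin 2) (Fin 2) ℤ) 0 1 with hb
  set c := (g : Matrix (Fin 2) (Fin 2) ℤ) 1 0 with hc
  set d := (g : Matrix (Fin 2) (Fin 2) ℤ) 1 1 with hd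
  have lin : ∀ (α β γ : ℤ), α * (∑ v ∈ T, v 0 ^ 2) + β * (∑ v ∈ T, v 0 * v 1)
      + γ * (∑ v ∈ T, v 1 ^ 2) = ∑ v ∈ T, (α * v 0 ^ 2 + β * (v 0 * v 1) + γ * v 1 ^ 2) := by
    intro α β γ
    rw [Finset.mul_sum, Finset.mul_sum, Finset.mul_sum, ← Finset.sum_add_distrib,
      ← Finset.sum_add_distrib]
  have f1 := (lin (a^2) (2*a*b) (b^2)).trans
    ((Finset.sum_congr rfl (fun v _ => by ring)).trans e1)
  have f2 := (lin (a*c) (a*d+b*c) (b*d)).trans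
    ((Finset.sum_congr rfl (fun v _ => by ring)).trans e2)
  have f3 := (lin (c^2) (2*c*d) (d^2)).trans
    ((Finset.sum_congr rfl (fun v _ => by ring)).trans e3)
  clear e1 e2 e3 lin
  generalize (∑ v ∈ T, v 0 ^ 2) = p at *
  generalize (∑ v ∈ T, v 0 * v 1) = q at *
  generalize (∑ v ∈ T, v 1 ^ 2) = r at *
  -- AQ = Q adj(A)^T
  have g1 : a * p + b * q = d * p - b * q := by
    linear_combination (-(a*p+b*q)) * hdet + d * f1 - b * f2
  have g2 : c * p + d * q = d * q - b * r := by
    linear_combination (-(c*p+d*q)) * hdet + d * f2 - b * f3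
  constructor
  · show c * p = -(r * b)
    linarith
  · show (d - a) * p = 2 * b * q
    linarith

lemma ellipse {p q r : ℤ} {A : Matrix (Fin 2) (Fin 2) ℤ} (hp : 0 < p) (hA : Pres p q r A)
    (hdet : A.det = 1) :
    p ^ 2 * (A 0 0 + A 1 1) ^ 2 + 4 * (p * r - q ^ 2) * (A 0 1) ^ 2 = 4 * p ^ 2 := by
  obtain ⟨h1, h2⟩ := hA
  rw [Matrix.det_fin_two] at hdet
  generalize A 0 0 = a at *
  generalize A 0 1 = b at *
  generalize A 1 0 = c at *
  generalize A 1 1 = d at *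
  linear_combination 4 * p ^ 2 * hdet + 4 * p * b * h1 + ((d - a) * p + 2 * b * q) * h2

/-- invariant -/
def inv2 (A : Matrix (Fin 2) (Fin 2) ℤ) : ℤ × ℤ := (A 0 0 + A 1 1, (A 0 1).sign)

lemma inv2_inj {p q r : ℤ} {A B : Matrix (Fin 2) (Fin 2) ℤ} (hp : 0 < p)
    (hD : 0 < p * r - q ^ 2) (hA : Pres p q r A) (hB : Pres p q r B)
    (hdA : A.det = 1) (hdB : B.det = 1) (h : inv2 A = inv2 B) : A = B := by
  have eA := ellipse hp hA hdA
  have eB := ellipse hp hB hdB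
  obtain ⟨ht, hs⟩ := Prod.mk.inj h
  have hb2 : A 0 1 ^ 2 = B 0 1 ^ 2 := by
    rw [ht] at eA
    have : (4 * (p * r - q ^ 2)) * A 0 1 ^ 2 = (4 * (p * r - q ^ 2)) * B 0 1 ^ 2 := by linarith
    exact mul_left_cancel₀ (by positivity) this
  have hb : A 0 1 = B 0 1 := by
    rw [← Int.sign_mul_abs (A 0 1), ← Int.sign_mul_abs (B 0 1), hs, (sq_eq_sq_iff_abs_eq_abs _ _).1 hb2]
  have hc : A 1 0 = B 1 0 := by
    apply mul_right_cancel₀ hp.ne'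
    rw [hA.1, hB.1, hb]
  have hd : A 1 1 - A 0 0 = B 1 1 - B 0 0 := by
    apply mul_right_cancel₀ hp.ne'
    rw [hA.2, hB.2, hb]
  ext i j
  fin_cases i <;> fin_cases j <;> simp <;> omega

lemma tr_two {p q r : ℤ} {A : Matrix (Fin 2) (Fin 2) ℤ} (hp : 0 < p)
    (hD : 0 < p * r - q ^ 2) (hA : Pres p q r A)
    (hdA : A.det = 1) (h : A 0 0 + A 1 1 = 2) : A = 1 := by
  apply inv2_inj hp hD hA (by simp [Pres]) hdA (by simp)
  have eA := ellipse hp hA hdA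
  rw [h] at eA
  have : (4 * (p * r - q ^ 2)) * A 0 1 ^ 2 = 0 := by linarith
  have hb : A 0 1 = 0 := by
    rcases mul_eq_zero.1 this with h | h
    · omega
    · exact pow_eq_zero_iff (two_ne_zero) |>.1 h
  simp [inv2, h, hb]

lemma tr_cases {p q r : ℤ} {A : Matrix (Fin 2) (Fin 2) ℤ} (hp : 0 < p)
    (hD : 0 < p * r - q ^ 2) (hA : Pres p q r A) (hdA : A.det = 1) :
    inv2 A ∈ ({(2,0),(-2,0)} : Finset (ℤ × ℤ)) ∨
    (inv2 A ∈ ({(0,1),(0,-1)} : Finset (ℤ × ℤ)) ∧ (p * r - q ^ 2) * A 0 1 ^ 2 = p ^ 2) ∨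
    (inv2 A ∈ ({(1,1),(1,-1),(-1,1),(-1,-1)} : Finset (ℤ × ℤ)) ∧
      4 * ((p * r - q ^ 2) * A 0 1 ^ 2) = 3 * p ^ 2) := by
  have eA := ellipse hp hA hdA
  unfold inv2
  generalize A 0 0 + A 1 1 = t at *
  generalize A 0 1 = b at *
  generalize p * r - q ^ 2 = D at *
  have hp2 : 0 < p ^ 2 := by positivity
  have ht : t ^ 2 ≤ 4 := by
    have : 0 ≤ D * b ^ 2 := by positivity
    by_contra! hh
    nlinarith
  have h1 : t ≤ 2 := by nlinarith
  have h2 : -2 ≤ t := by nlinarith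
  have hb : b ≠ 0 → b.sign = 1 ∨ b.sign = -1 := by
    intro hb
    rcases lt_or_gt_of_ne hb with h | h
    · right; exact Int.sign_eq_neg_one_of_neg h
    · left; exact Int.sign_eq_one_of_pos h
  have hb0 : D * b ^ 2 = 0 → b = 0 := by
    intro h
    rcases mul_eq_zero.1 h with h | h
    · omega
    · exact pow_eq_zero_iff (two_ne_zero) |>.1 h
  have hbn : D * b ^ 2 ≠ 0 → b ≠ 0 := by
    rintro h rfl
    simp at h
  have : t = -2 ∨ t = -1 ∨ t = 0 ∨ t = 1 ∨ t = 2 := by omega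
  rcases this with rfl | rfl | rfl | rfl | rfl
  · left; rw [hb0 (by linarith)]; simp
  · right; right
    refine ⟨?_, by linarith⟩
    rcases hb (hbn (by intro h; linarith)) with h | h <;> simp [h]
  · right; left
    refine ⟨?_, by linarith⟩
    rcases hb (hbn (by intro h; linarith)) with h | h <;> simp [h]
  · right; right
    refine ⟨?_, by linarith⟩
    rcases hb (hbn (by intro h; linarith)) with h | h <;> simp [h]
  · left; rw [hb0 (by linarith)]; simp

lemma no_sqrt3 (x y : ℤ) (hx : x ≠ 0) (h : 4 * y ^ 2 = 3 * x ^ 2) : False := by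
  have h3 : Irrational (√(3:ℝ)) := Nat.Prime.irrational_sqrt (p := 3) (by norm_num)
  apply h3
  have hx' : (x : ℝ) ≠ 0 := by exact_mod_cast hx
  have h' : 4 * (y : ℝ) ^ 2 = 3 * x ^ 2 := by exact_mod_cast h
  refine ⟨|2 * (y : ℚ) / x|, ?_⟩
  push_cast
  rw [← Real.sqrt_sq_eq_abs]
  congr 1
  field_simp
  linarith

/-- The determinant one subgroup. -/
def rotH (T : Finset (Fin 2 → ℤ)) : Subgroup (symG T) :=
  (Matrix.GeneralLinearGroup.det.comp (symG T).subtype).ker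

lemma rotH_det (T : Finset (Fin 2 → ℤ)) (g : rotH T) :
    (((g : symG T) : GL (Fin 2) ℤ) : Matrix (Fin 2) (Fin 2) ℤ).det = 1 := by
  have := g.2
  unfold rotH at this
  rw [MonoidHom.mem_ker] at this
  have h2 := congrArg Units.val this
  simpa using h2

/-- Matrix of element. -/
def mtx {T : Finset (Fin 2 → ℤ)} (g : rotH T) : Matrix (Fin 2) (Fin 2) ℤ :=
  (((g : symG T) : GL (Fin 2) ℤ) : Matrix (Fin 2) (Fin 2) ℤ)

lemma mtx_inj {T : Finset (Fin 2 → ℤ)} : Function.Injective (mtx (T := T)) := by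
  intro g h e
  exact Subtype.ext (Subtype.ext (Units.ext e))

section
variable {T : Finset (Fin 2 → ℤ)} {u w : Fin 2 → ℤ}

lemma p_pos (hu : u ∈ T) (hw : w ∈ T)
    (h : u 0 * w 1 - w 0 * u 1 ≠ 0) : 0 < ∑ v ∈ T, v 0 ^ 2 := by
  have h1 := disc_pos T u w hu hw h
  have h2 : 0 ≤ ∑ v ∈ T, v 0 ^ 2 := Finset.sum_nonneg (fun _ _ => sq_nonneg _)
  rcases h2.lt_or_eq with h3 | h3
  · exact h3
  · rw [← h3] at h1
    nlinarith [sq_nonneg (∑ v ∈ T, v 0 * v 1)]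

lemma card_le_T (hu : u ∈ T) (hw : w ∈ T)
    (h : u 0 * w 1 - w 0 * u 1 ≠ 0) (z : Fin 2 → ℤ) (hz : z ∈ T) (hz0 : z ≠ 0) :
    Nat.card (rotH T) ≤ T.card := by
  have hD := disc_pos T u w hu hw h
  have hp := p_pos hu hw h
  have hpres := fun g : rotH T => pres_of_mem T _ g.1.2 (rotH_det T g)
  rw [← Fintype.card_coe, ← Nat.card_eq_fintype_card]
  refine Nat.card_le_card_of_injective
    (fun g : rotH T => (⟨mtx g *ᵥ z, (g.1.2 z).2 hz⟩ : T)) ?_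
  intro g k hgk
  have e : mtx g *ᵥ z = mtx k *ᵥ z := congrArg Subtype.val hgk
  have e2 : mtx (k⁻¹ * g) *ᵥ z = z := by
    have : mtx (k⁻¹ * g) = mtx k⁻¹ * mtx g := rfl
    rw [this, ← Matrix.mulVec_mulVec, e, Matrix.mulVec_mulVec]
    have : mtx k⁻¹ * mtx k = mtx (k⁻¹ * k) := rfl
    rw [this, inv_mul_cancel]
    exact Matrix.one_mulVec z
  have e3 : (mtx (k⁻¹ * g) - 1).det = 0 := by
    apply Matrix.exists_mulVec_eq_zero_iff.1
    exact ⟨z, hz0, by rw [Matrix.sub_mulVec, e2, Matrix.one_mulVec, sub_self]⟩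
  have hd : (mtx (k⁻¹ * g)).det = 1 := rotH_det T (k⁻¹ * g)
  have e4 : mtx (k⁻¹ * g) = 1 := by
    apply tr_two hp hD (hpres (k⁻¹ * g)) hd
    rw [Matrix.det_fin_two] at e3 hd
    simp at e3
    change mtx (k⁻¹ * g) 0 0 + mtx (k⁻¹ * g) 1 1 = 2
    linarith
  have e5 : k⁻¹ * g = 1 := mtx_inj e4
  exact (inv_mul_eq_one.1 e5).symm

lemma card_le_six (hu : u ∈ T) (hw : w ∈ T)
    (h : u 0 * w 1 - w 0 * u 1 ≠ 0) : Nat.card (rotH T) ≤ 6 := by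
  have hD := disc_pos T u w hu hw h
  have hp := p_pos hu hw h
  have hpres := fun g : rotH T => pres_of_mem T _ g.1.2 (rotH_det T g)
  have main : ∀ S : Finset (ℤ × ℤ), (∀ g : rotH T, inv2 (mtx g) ∈ S) →
      Nat.card (rotH T) ≤ S.card := by
    intro S hS
    rw [← Fintype.card_coe, ← Nat.card_eq_fintype_card]
    refine Nat.card_le_card_of_injective (fun g : rotH T => (⟨inv2 (mtx g), hS g⟩ : S)) ?_
    intro g k hgk
    exact mtx_inj (inv2_inj hp hD (hpres g) (hpres k) (rotH_det T g) (rotH_det T k)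
      (congrArg Subtype.val hgk))
  have cas := fun g : rotH T => tr_cases hp hD (hpres g) (rotH_det T g)
  by_cases h4 : ∃ g : rotH T, inv2 (mtx g) ∈ ({(0,1),(0,-1)} : Finset (ℤ × ℤ))
  · refine (main {(2,0),(-2,0),(0,1),(0,-1)} ?_).trans (by decide)
    obtain ⟨g, hg⟩ := h4
    have hg' : (mtx g) 0 1 ≠ 0 ∧ ((∑ v ∈ T, v 0 ^ 2) * (∑ v ∈ T, v 1 ^ 2) - (∑ v ∈ T, v 0 * v 1) ^ 2)
        * (mtx g) 0 1 ^ 2 = (∑ v ∈ T, v 0 ^ 2) ^ 2 := by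
      constructor
      · intro h0
        simp [inv2, h0] at hg
      · rcases cas g with hc | hc | hc
        · exfalso
          change inv2 (mtx g) ∈ _ at hc
          generalize inv2 (mtx g) = x at *
          simp only [Finset.mem_insert, Finset.mem_singleton] at hg hc
          rcases hg with rfl | rfl <;> simp at hc
        · exact hc.2
        · exfalso
          replace hc := hc.1
          change inv2 (mtx g) ∈ _ at hc
          generalize inv2 (mtx g) = x at *
          simp only [Finset.mem_insert, Finset.mem_singleton] at hg hc
          rcases hg with rfl | rfl <;> simp at hc
    intro k
    rcases cas k with hc | hc | hc
    · change inv2 (mtx k) ∈ _ at hc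
      simp only [Finset.mem_insert, Finset.mem_singleton] at hc ⊢
      tauto
    · replace hc := hc.1
      change inv2 (mtx k) ∈ _ at hc
      simp only [Finset.mem_insert, Finset.mem_singleton] at hc ⊢
      tauto
    · exfalso
      replace hc := hc.2
      apply no_sqrt3 ((mtx g) 0 1) ((mtx k) 0 1) hg'.1
      change 4 * (_ * (mtx k) 0 1 ^ 2) = _ at hc
      rw [← hg'.2] at hc
      apply mul_left_cancel₀ hD.ne'
      linarith
  · refine (main {(2,0),(-2,0),(1,1),(1,-1),(-1,1),(-1,-1)} ?_).trans (by decide)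
    intro k
    rcases cas k with hc | hc | hc
    · change inv2 (mtx k) ∈ _ at hc
      simp only [Finset.mem_insert, Finset.mem_singleton] at hc ⊢
      tauto
    · exact absurd ⟨k, hc.1⟩ h4
    · replace hc := hc.1
      change inv2 (mtx k) ∈ _ at hc
      simp only [Finset.mem_insert, Finset.mem_singleton] at hc ⊢
      tauto

lemma pow5 (A : Matrix (Fin 2) (Fin 2) ℤ) (hd : A.det = 1) (h5 : A ^ 5 = 1)
    (h1 : -2 ≤ A 0 0 + A 1 1) (h2 : A 0 0 + A 1 1 ≤ 2) : A 0 0 + A 1 1 = 2 := by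
  obtain ⟨t, ht⟩ : ∃ t : ℤ, A 0 0 + A 1 1 = t := ⟨_, rfl⟩
  have hCH : A * A = t • A - 1 := by
    rw [Matrix.det_fin_two] at hd
    rw [← ht]
    ext i j
    fin_cases i <;> fin_cases j <;> simp [Matrix.mul_apply, Fin.sum_univ_two, -zsmul_eq_mul] <;> linarith
  rw [ht] at h1 h2 ⊢
  have hA5 : A ^ 5 = (t^4 - 3*t^2+1) • A - (t^3 - 2 * t) • (1 : Matrix (Fin 2) (Fin 2) ℤ) := by
    have e2 : A ^ 2 = t • A - 1 := by rw [pow_two, hCH]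
    have e3 : A ^ 3 = (t^2 - 1) • A - t • (1 : Matrix (Fin 2) (Fin 2) ℤ) := by
      rw [pow_succ, e2, sub_mul, smul_mul_assoc, hCH, one_mul]
      module
    have e4 : A ^ 4 = (t^3 - 2*t) • A - (t^2-1) • (1 : Matrix (Fin 2) (Fin 2) ℤ) := by
      rw [pow_succ, e3, sub_mul, smul_mul_assoc, hCH, smul_mul_assoc, one_mul]
      module
    rw [pow_succ, e4, sub_mul, smul_mul_assoc, hCH, smul_mul_assoc, one_mul]
    module
  rw [h5] at hA5
  have k0 := congrFun (congrFun hA5 0) 0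
  have k1 := congrFun (congrFun hA5 1) 1
  simp only [Matrix.sub_apply, Matrix.smul_apply, Matrix.one_apply_eq, smul_eq_mul] at k0 k1
  have : t = -2 ∨ t = -1 ∨ t = 0 ∨ t = 1 ∨ t = 2 := by omega
  rcases this with rfl | rfl | rfl | rfl | rfl <;> norm_num at k0 k1 ⊢ <;> omega

lemma card_ne_five (hu : u ∈ T) (hw : w ∈ T)
    (h : u 0 * w 1 - w 0 * u 1 ≠ 0) : Nat.card (rotH T) ≠ 5 := by
  intro hcard
  have hD := disc_pos T u w hu hw h
  have hp := p_pos hu hw h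
  have hpres := fun g : rotH T => pres_of_mem T _ g.1.2 (rotH_det T g)
  have hall : ∀ g : rotH T, g = 1 := by
    intro g
    have e : g ^ 5 = 1 := by rw [← hcard]; exact pow_card_eq_one'
    have e2 : mtx g ^ 5 = 1 := by
      have : mtx (g ^ 5) = mtx g ^ 5 := rfl
      rw [← this, e]; rfl
    have hb : -2 ≤ (mtx g) 0 0 + (mtx g) 1 1 ∧ (mtx g) 0 0 + (mtx g) 1 1 ≤ 2 := by
      have hc : (inv2 (mtx g)).1 = (mtx g) 0 0 + (mtx g) 1 1 := rfl
      rw [← hc]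
      rcases tr_cases hp hD (hpres g) (rotH_det T g) with hc | ⟨hc, -⟩ | ⟨hc, -⟩ <;>
      · change inv2 (mtx g) ∈ _ at hc
        generalize inv2 (mtx g) = x at *
        simp only [Finset.mem_insert, Finset.mem_singleton] at hc
        aesop
    exact mtx_inj (tr_two hp hD (hpres g) (rotH_det T g) (pow5 _ (rotH_det T g) e2 hb.1 hb.2))
  have : Subsingleton (rotH T) := ⟨fun a b => by rw [hall a, hall b]⟩
  rw [Nat.card_of_subsingleton 1] at hcard
  omega

lemma finite_G (hu : u ∈ T) (hw : w ∈ T)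
    (h : u 0 * w 1 - w 0 * u 1 ≠ 0) : Finite (symG T) := by
  refine Finite.of_injective (β := T × T) (fun g => (⟨(g : GL (Fin 2) ℤ).1 *ᵥ u, (g.2 u).2 hu⟩,
    ⟨(g : GL (Fin 2) ℤ).1 *ᵥ w, (g.2 w).2 hw⟩)) ?_
  intro g k e
  obtain ⟨e1, e2⟩ := Prod.mk.inj e
  replace e1 := congrArg Subtype.val e1
  replace e2 := congrArg Subtype.val e2
  simp only at e1 e2
  clear e
  apply Subtype.ext
  apply Units.ext
  generalize (g : GL (Fin 2) ℤ).1 = A at *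
  generalize (k : GL (Fin 2) ℤ).1 = B at *
  have hrow : ∀ i, A i 0 = B i 0 ∧ A i 1 = B i 1 := by
    intro i
    have c1 := congrFun e1 i
    have c2 := congrFun e2 i
    simp only [Matrix.mulVec, dotProduct, Fin.sum_univ_two] at c1 c2
    constructor
    · apply mul_right_cancel₀ h
      linear_combination w 1 * c1 - u 1 * c2
    · apply mul_right_cancel₀ h
      linear_combination u 0 * c2 - w 0 * c1
  ext i j
  fin_cases j
  · exact (hrow i).1
  · exact (hrow i).2

lemma card_G_le [Finite (symG T)] : Nat.card (symG T) ≤ 2 * Nat.card (rotH T) := by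
  have h1 := Subgroup.card_mul_index (rotH T)
  have h2 : (rotH T).index ≤ 2 := by
    unfold rotH
    rw [Subgroup.index_ker]
    have : Nat.card ℤˣ = 2 := by rw [Nat.card_eq_fintype_card]; rfl
    refine le_of_le_of_eq ?_ this
    exact Nat.card_le_card_of_injective _ Subtype.val_injective
  rw [← h1]
  nlinarith
end

/-- Affine symmetries give linear ones. -/
lemma sym_of_affine (m : ℕ) (hm : 3 ≤ m) (V : Fin m → Fin 2 → ℤ) (hinj : Function.Injective V)
    (A : Matrix (Fin 2) (Fin 2) ℤ) (b : Fin 2 → ℤ) (hdet : A.det = 1 ∨ A.det = -1)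
    (himg : (fun x => A.mulVec x + b) '' Set.range V = Set.range V) :
    ∃ g ∈ symG (Finset.univ.image (Wv m V)), ∀ i j, A.mulVec (V i) + b = V j →
      (g : GL (Fin 2) ℤ).1 *ᵥ Wv m V i = Wv m V j := by
  have hs : ∀ i, ∃ j, V j = A.mulVec (V i) + b := by
    intro i
    have : A.mulVec (V i) + b ∈ Set.range V := by
      rw [← himg]; exact ⟨V i, ⟨i, rfl⟩, rfl⟩
    exact this
  choose σ hσ using hs
  have hsurj : Function.Surjective σ := by
    intro j
    have : V j ∈ Set.range V := ⟨j, rfl⟩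
    rw [← himg] at this
    obtain ⟨_, ⟨i, rfl⟩, hi⟩ := this
    exact ⟨i, hinj ((hσ i).trans hi)⟩
  have hbij : Function.Bijective σ := Finite.surjective_iff_bijective.1 hsurj
  have hsum : ∑ j, V j = A *ᵥ (∑ j, V j) + (m : ℤ) • b := by
    conv_lhs => rw [← hbij.sum_comp V]
    simp only [hσ]
    rw [Finset.sum_add_distrib, Matrix.mulVec_sum]
    simp
  have hW : ∀ i, A *ᵥ Wv m V i = Wv m V (σ i) := by
    intro i
    unfold Wv
    rw [Matrix.mulVec_sub, Matrix.mulVec_smul, hσ, smul_add]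
    conv_rhs => rw [hsum]
    abel
  have hu : IsUnit A.det := by
    rcases hdet with h | h <;> simp [h]
  refine ⟨Matrix.GeneralLinearGroup.mk'' A hu, ?_, ?_⟩
  · intro x
    change A *ᵥ x ∈ _ ↔ _
    simp only [Finset.mem_image, Finset.mem_univ, true_and]
    constructor
    · rintro ⟨j, hj⟩
      obtain ⟨i, rfl⟩ := hsurj j
      refine ⟨i, ?_⟩
      rw [← hW] at hj
      exact Matrix.mulVec_injective_of_isUnit ((Matrix.isUnit_iff_isUnit_det A).2 hu) hj
    · rintro ⟨i, rfl⟩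
      exact ⟨σ i, (hW i).symm⟩
  · intro i j hij
    change A *ᵥ _ = _
    rw [hW, ← hinj ((hσ i).trans hij)]

/-- A lattice-regular convex lattice polygon has 3, 4, or 6 vertices;
in particular a convex lattice polygon with more than 6 vertices cannot be
lattice-regular. -/
theorem lattice_regular_polygon_three_four_or_six
    (m : ℕ) [NeZero m] (hm : 3 ≤ m)
    (V : Fin m → Fin 2 → ℤ) (hinj : Function.Injective V)
    (hconv : ConvexPosition m V) (hreg : LatticeRegular m V) :
    m = 3 ∨ m = 4 ∨ m = 6 := by
  classical
  set T := Finset.univ.image (Wv m V) with hT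
  have hmem : ∀ i, Wv m V i ∈ T := fun i => Finset.mem_image_of_mem _ (Finset.mem_univ i)
  have hcT : T.card = m := by
    rw [hT, Finset.card_image_of_injective _ (Wv_inj m hm V hinj)]; simp
  obtain ⟨i₀, j₀, hx⟩ := exists_cross m hm V hconv
  have c1 := card_le_T (hmem i₀) (hmem j₀) hx _ (hmem 0) (Wv_ne_zero m hm V hconv 0)
  have c2 := card_le_six (hmem i₀) (hmem j₀) hx
  have c3 := card_ne_five (hmem i₀) (hmem j₀) hx
  have hfin := finite_G (hmem i₀) (hmem j₀) hx
  have c4 := card_G_le (T := T)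
  let F : Fin m × Bool → Fin m × Fin m := fun x => if x.2 then (x.1, x.1 + 1) else (x.1 + 1, x.1)
  have hF : ∀ x, AdjPair m V (V (F x).1) (V (F x).2) := by
    rintro ⟨i, s⟩
    refine ⟨i, ?_⟩
    cases s <;> simp [F]
  have hex : ∀ x, ∃ g : symG T, (g : GL (Fin 2) ℤ).1 *ᵥ Wv m V 0 = Wv m V (F x).1 ∧
      (g : GL (Fin 2) ℤ).1 *ᵥ Wv m V (0 + 1) = Wv m V (F x).2 := by
    intro x
    obtain ⟨A, b, hd, himg, h1, h2⟩ := hreg _ _ _ _ (hF (0, true)) (hF x)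
    obtain ⟨g, hg, hgW⟩ := sym_of_affine m hm V hinj A b hd himg
    exact ⟨⟨g, hg⟩, hgW _ _ h1, hgW _ _ h2⟩
  choose φ hφ using hex
  have htwo : ∀ j : Fin m, j + 1 + 1 ≠ j := by
    intro j hj
    have h1 : (1 + 1 : Fin m) = 0 := by
      rw [add_assoc] at hj
      exact add_eq_left.1 hj
    have h2 := congrArg Fin.val h1
    rw [Fin.val_add, Fin.val_one', Fin.val_zero, Nat.mod_eq_of_lt (show 1 < m by omega),
      Nat.mod_eq_of_lt (show 1 + 1 < m by omega)] at h2
    omega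
  have hφi : Function.Injective φ := by
    intro x y hxy
    have e1 := (hφ x).1
    have e2 := (hφ x).2
    rw [hxy, (hφ y).1] at e1
    rw [hxy, (hφ y).2] at e2
    have e1 := Wv_inj m hm V hinj e1
    have e2 := Wv_inj m hm V hinj e2
    obtain ⟨i, s⟩ := x
    obtain ⟨j, t⟩ := y
    cases s <;> cases t <;> simp [F] at e1 e2
    · rw [e2]
    · exact absurd (by rw [← e1, e2]) (htwo i)
    · exact absurd (by rw [← e2, e1]) (htwo i)
    · rw [e1]
  have c5 := Nat.card_le_card_of_injective φ hφi
  have : Nat.card (Fin m × Bool) = m * 2 := by simp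
  rw [this] at c5
  rw [hcT] at c1
  omega
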